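/- arXiv:1410.5013 — 12 statements merged into one kernel-verified Lean document; each statement's English description precedes it below -/
import Mathlib

section
/- Let u : ℝ → ℂ be differentiable, and let λ, λ₁ ∈ ℂ. Suppose y₁ : ℝ → ℂ is twice differentiable, nowhere vanishing, and satisfies y₁''(x) + (λ₁ − u(x))·y₁(x) = 0 for all x, and suppose y : ℝ → ℂ is twice differentiable and satisfies y''(x) + (λ − u(x))·y(x) = 0 for all x. Define the logarithmic derivative l₁(x) = y₁'(x)/y₁(x), the transformed eigenfunction y⁽¹⁾(x) = y'(x) − l₁(x)·y(x), and the transformed potential u⁽¹⁾(x) = u(x) − 2·l₁'(x). Then y⁽¹⁾ satisfies the Sturm–Liouville equation with the new potential: (y⁽¹⁾)''(x) + (λ − u⁽¹⁾(x))·y⁽¹⁾(x) = 0 for all x. -/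
/-- The logarithmic derivative of a nonvanishing solution of `f'' + (c − u)f = 0` satisfies the
Riccati equation `l' = u − c − l²`. -/
theorem hasDerivAt_logDeriv_of_sturmLiouville {u f : ℝ → ℂ} {c : ℂ} {x : ℝ}
    (hf : DifferentiableAt ℝ f x) (hf' : DifferentiableAt ℝ (deriv f) x) (hne : f x ≠ 0)
    (heq : deriv (deriv f) x + (c - u x) * f x = 0) :
    HasDerivAt (fun t => deriv f t / f t) (u x - c - (deriv f x / f x) ^ 2) x := by
  refine (hf'.hasDerivAt.fun_div hf.hasDerivAt hne).congr_deriv ?_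
  field_simp
  linear_combination f x * heq


/-- **Darboux's theorem** for the Sturm–Liouville equation `y'' + (λ − u)y = 0`:
the transformed eigenfunction `y⁽¹⁾ = y' − (y₁'/y₁)·y` satisfies the same equation
with the transformed potential `u⁽¹⁾ = u − 2·(y₁'/y₁)'`. -/
theorem darboux_theorem
    (u : ℝ → ℂ) (hu : Differentiable ℝ u) (lam lam₁ : ℂ)
    (y₁ y : ℝ → ℂ)
    (hy₁ : Differentiable ℝ y₁) (hy₁' : Differentiable ℝ (deriv y₁))
    (hy₁ne : ∀ x, y₁ x ≠ 0)
    (heq₁ : ∀ x, deriv (deriv y₁) x + (lam₁ - u x) * y₁ x = 0)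
    (hy : Differentiable ℝ y) (hy' : Differentiable ℝ (deriv y))
    (heq : ∀ x, deriv (deriv y) x + (lam - u x) * y x = 0) :
    ∀ x, deriv (deriv (fun t => deriv y t - (deriv y₁ t / y₁ t) * y t)) x
        + (lam - (u x - 2 * deriv (fun t => deriv y₁ t / y₁ t) x))
          * (deriv y x - (deriv y₁ x / y₁ x) * y x) = 0 := by
  have hl x := hasDerivAt_logDeriv_of_sturmLiouville (hy₁ x) (hy₁' x) (hy₁ne x) (heq₁ x)
  have hz x : HasDerivAt (fun t => deriv y t - (deriv y₁ t / y₁ t) * y t)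
      ((lam₁ - lam) * y x
        - (deriv y₁ x / y₁ x) * (deriv y x - (deriv y₁ x / y₁ x) * y x)) x := by
    refine ((hy' x).hasDerivAt.fun_sub ((hl x).fun_mul (hy x).hasDerivAt)).congr_deriv ?_
    linear_combination heq x
  intro x
  have hz' := ((hy x).hasDerivAt.const_mul (lam₁ - lam)).fun_sub ((hl x).fun_mul (hz x))
  rw [funext fun t => (hz t).deriv, hz'.deriv, (hl x).deriv]
  ring
end

section
/- Let u : ℝ → ℂ be infinitely differentiable, let λ, λ₁, …, λₙ ∈ ℂ, and let y, y₁, …, yₙ : ℝ → ℂ be infinitely differentiable functions satisfying y''(x) + (λ − u(x))·y(x) = 0 and yⱼ''(x) + (λⱼ − u(x))·yⱼ(x) = 0 for all x and j = 1, …, n. For functions f₁, …, f_k denote by W[f₁,…,f_k](x) the Wronskian determinant, i.e. the determinant of the k×k matrix whose (i,j) entry is the (i−1)-st derivative of f_j at x. Assume W[y₁,…,yₙ](x) ≠ 0 for all x. Define y⁽ⁿ⁾(x) = W[y₁,…,yₙ,y](x) / W[y₁,…,yₙ](x) and u⁽ⁿ⁾(x) = u(x) − 2·(d/dx)( W[y₁,…,yₙ]'(x)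 / W[y₁,…,yₙ](x) ) (equivalently u − 2(ln W[y₁,…,yₙ])''). Then (y⁽ⁿ⁾)''(x) + (λ − u⁽ⁿ⁾(x))·y⁽ⁿ⁾(x) = 0 for all x. -/
/-- The Wronskian determinant `W[f₁,…,f_k](x)`: the determinant of the `k×k` matrix
whose `(i,j)` entry is the `(i-1)`-st derivative of `f_j` at `x` (0-indexed). -/
noncomputable def wronskian {k : ℕ} (F : Fin k → ℝ → ℂ) (x : ℝ) : ℂ :=
  (Matrix.of fun i j : Fin k => iteratedDeriv (i : ℕ) (F j) x).det

open scoped ContDiff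

/-- The Wronskian matrix of `F` at `x`, whose determinant is `wronskian F x`. -/
noncomputable def wronskianMatrix {k : ℕ} (F : Fin k → ℝ → ℂ) (x : ℝ) : Matrix (Fin k) (Fin k) ℂ :=
  Matrix.of fun i j => iteratedDeriv (i : ℕ) (F j) x

/-- The monic differential operator `f ↦ f⁽ⁿ⁾ + ∑ k < n, a k * f⁽ᵏ⁾`. -/
noncomputable def monicDiffOp {n : ℕ} (a : Fin n → ℝ → ℂ) (f : ℝ → ℂ) (x : ℝ) : ℂ :=
  iteratedDeriv n f x + ∑ k : Fin n, a k x * iteratedDeriv (k : ℕ) f x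

/-- The coefficients of the monic differential operator of order `n` annihilating every `Y j`. -/
noncomputable def annihilatorCoeff {n : ℕ} (Y : Fin n → ℝ → ℂ) (k : Fin n) (x : ℝ) : ℂ :=
  -(Matrix.vecMul (fun j => iteratedDeriv n (Y j) x) (wronskianMatrix Y x)⁻¹) k

/-- The linear functionals on smooth functions spanned by the derivatives at `x` of order less
than `n`. -/
noncomputable def jetSpan (n : ℕ) (x : ℝ) : Submodule ℂ ({f : ℝ → ℂ // ContDiff ℝ ∞ f} → ℂ) :=
  Submodule.span ℂ (Set.range fun (k : Fin n) f => iteratedDeriv (k : ℕ) f.1 x)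

theorem ContDiff.iteratedDeriv_infty {f : ℝ → ℂ} (hf : ContDiff ℝ ∞ f) (k : ℕ) :
    ContDiff ℝ ∞ (iteratedDeriv k f) := by
  rw [iteratedDeriv_eq_iterate]
  exact hf.iterate_deriv k

theorem ContDiff.hasDerivAt_iteratedDeriv {f : ℝ → ℂ} (hf : ContDiff ℝ ∞ f) (k : ℕ) (x : ℝ) :
    HasDerivAt (iteratedDeriv k f) (iteratedDeriv (k + 1) f x) x := by
  rw [iteratedDeriv_succ]
  exact ((hf.iteratedDeriv_infty k).differentiable (by simp)).differentiableAt.hasDerivAt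

theorem contDiff_matrix_det {m : ℕ} {A : ℝ → Matrix (Fin m) (Fin m) ℂ}
    (hA : ∀ i j, ContDiff ℝ ∞ fun x => A x i j) : ContDiff ℝ ∞ fun x => (A x).det := by
  simp only [Matrix.det_apply']
  exact ContDiff.sum fun σ _ => contDiff_const.mul (contDiff_prod fun i _ => hA _ _)

theorem hasDerivAt_matrix_det {m : ℕ} {A : ℝ → Matrix (Fin m) (Fin m) ℂ}
    {A' : Matrix (Fin m) (Fin m) ℂ} {x : ℝ}
    (hA : ∀ i j, HasDerivAt (fun t => A t i j) (A' i j) x) :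
    HasDerivAt (fun t => (A t).det) (∑ i, ((A x).updateRow i (A' i)).det) x := by
  have h : HasDerivAt (fun t => ∑ σ : Equiv.Perm (Fin m), ((Equiv.Perm.sign σ : ℤ) : ℂ) *
      ∏ i, A t i (σ i)) (∑ σ : Equiv.Perm (Fin m), ((Equiv.Perm.sign σ : ℤ) : ℂ) *
      ∑ i, (∏ j ∈ Finset.univ.erase i, A x j (σ j)) • A' i (σ i)) x :=
    HasDerivAt.fun_sum fun σ _ => (HasDerivAt.fun_finsetProd fun i _ => hA i (σ i)).const_mul _
  convert h using 1
  · ext t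
    rw [← Matrix.det_transpose, Matrix.det_apply']
    rfl
  · simp_rw [Finset.mul_sum]
    rw [Finset.sum_comm]
    refine Finset.sum_congr rfl fun i _ => ?_
    rw [← Matrix.det_transpose, Matrix.det_apply']
    refine Finset.sum_congr rfl fun σ _ => ?_
    rw [← Finset.prod_erase_mul _ _ (Finset.mem_univ i)]
    simp only [Matrix.transpose_apply, Matrix.updateRow_self, smul_eq_mul]
    congr 2
    refine Finset.prod_congr rfl fun j hj => ?_
    rw [Matrix.updateRow_ne (Finset.ne_of_mem_erase hj)]

section Wronskian

variable {n : ℕ} {Y : Fin n → ℝ → ℂ}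

theorem contDiff_wronskian (hY : ∀ j, ContDiff ℝ ∞ (Y j)) : ContDiff ℝ ∞ (wronskian Y) :=
  contDiff_matrix_det fun i j => (hY j).iteratedDeriv_infty i

theorem contDiff_annihilatorCoeff (hY : ∀ j, ContDiff ℝ ∞ (Y j)) (hW : ∀ x, wronskian Y x ≠ 0)
    (k : Fin n) : ContDiff ℝ ∞ (annihilatorCoeff Y k) := by
  have h : annihilatorCoeff Y k = fun x => -∑ j, iteratedDeriv n (Y j) x *
      ((wronskian Y x)⁻¹ * ((wronskianMatrix Y x).updateRow k (Pi.single j 1)).det) := by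
    ext x
    simp only [annihilatorCoeff, Matrix.vecMul, dotProduct, Matrix.inv_def, Ring.inverse_eq_inv',
      Matrix.smul_apply, Matrix.adjugate_apply, smul_eq_mul]
    rfl
  rw [h]
  refine ContDiff.neg (ContDiff.sum fun j _ => ((hY j).iteratedDeriv_infty n).mul
    (((contDiff_wronskian hY).inv hW).mul (contDiff_matrix_det fun i l => ?_)))
  by_cases hik : i = k
  · subst hik
    simpa only [Matrix.updateRow_self] using contDiff_const
  · simp only [Matrix.updateRow_ne hik]
    exact (hY l).iteratedDeriv_infty i

theorem monicDiffOp_annihilatorCoeff {x : ℝ} (hW : wronskian Y x ≠ 0) (j : Fin n) :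
    monicDiffOp (annihilatorCoeff Y) (Y j) x = 0 := by
  have h : Matrix.vecMul (fun k => annihilatorCoeff Y k x) (wronskianMatrix Y x) =
      -fun j => iteratedDeriv n (Y j) x := by
    have : (fun k => annihilatorCoeff Y k x) =
      -Matrix.vecMul (fun j => iteratedDeriv n (Y j) x) (wronskianMatrix Y x)⁻¹ := rfl
    rw [this, Matrix.neg_vecMul, Matrix.vecMul_vecMul,
      Matrix.nonsing_inv_mul (wronskianMatrix Y x) (isUnit_iff_ne_zero.2 hW), Matrix.vecMul_one]
  have h' : ∑ k, annihilatorCoeff Y k x * iteratedDeriv k (Y j) x = -iteratedDeriv n (Y j) x :=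
    congrFun h j
  rw [monicDiffOp, h', add_neg_cancel]

theorem wronskian_snoc {a : Fin n → ℝ → ℂ} {x : ℝ} (ha : ∀ j, monicDiffOp a (Y j) x = 0)
    (f : ℝ → ℂ) : wronskian (Fin.snoc Y f) x = wronskian Y x * monicDiffOp a f x := by
  set B := wronskianMatrix (Fin.snoc Y f) x with hB
  have hrow : ∀ j, (∑ k, (Fin.snoc (fun k => a k x) 1 : Fin (n + 1) → ℂ) k • B k) j =
      monicDiffOp a ((Fin.snoc Y f : Fin (n + 1) → ℝ → ℂ) j) x := by
    intro j
    simp [Fin.sum_univ_castSucc, hB, wronskianMatrix, monicDiffOp, add_comm]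
  have h := Matrix.det_updateRow_sum B (Fin.last n) (Fin.snoc (fun k => a k x) 1)
  rw [Matrix.det_succ_row _ (Fin.last n), Finset.sum_eq_single (Fin.last n)] at h
  · rw [Matrix.updateRow_self, hrow, Fin.snoc_last, Fin.snoc_last, one_smul,
      Even.neg_one_pow ⟨_, rfl⟩, one_mul, mul_comm] at h
    refine h.symm.trans (congrArg₂ _ (congrArg _ ?_) rfl)
    ext i j
    simp [hB, wronskianMatrix]
  · intro j _ hj
    obtain ⟨i, rfl⟩ := Fin.exists_castSucc_eq.2 hj
    rw [Matrix.updateRow_self, hrow, Fin.snoc_castSucc, ha]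
    simp
  · simp

end Wronskian

theorem deriv_wronskian {m : ℕ} {Y : Fin (m + 1) → ℝ → ℂ} (hY : ∀ j, ContDiff ℝ ∞ (Y j))
    {a : Fin (m + 1) → ℝ → ℂ} {x : ℝ} (ha : ∀ j, monicDiffOp a (Y j) x = 0) :
    deriv (wronskian Y) x = -a (Fin.last m) x * wronskian Y x := by
  have h := hasDerivAt_matrix_det (A := wronskianMatrix Y)
    (A' := Matrix.of fun i j => iteratedDeriv ((i : ℕ) + 1) (Y j) x) (x := x)
    fun i j => (hY j).hasDerivAt_iteratedDeriv i x
  refine h.deriv.trans ?_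
  rw [Fin.sum_univ_castSucc, Finset.sum_eq_zero, zero_add]
  · refine Eq.trans ?_ (Matrix.det_updateRow_sum (wronskianMatrix Y x) (Fin.last m)
      fun k => -a k x)
    congr 2
    ext j
    have := ha j
    rw [monicDiffOp] at this
    simp [wronskianMatrix, eq_neg_of_add_eq_zero_left this]
  · intro i _
    refine Matrix.det_zero_of_row_eq (i := i.castSucc) (j := i.succ) (Fin.castSucc_lt_succ).ne ?_
    rw [Matrix.updateRow_self, Matrix.updateRow_ne (Fin.castSucc_lt_succ).ne']
    ext j
    simp [wronskianMatrix]

theorem iteratedDeriv_mem_jetSpan {n k : ℕ} (hk : k < n) (x : ℝ) :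
    (fun f => iteratedDeriv k f.1 x) ∈ jetSpan n x :=
  Submodule.subset_span ⟨⟨k, hk⟩, rfl⟩

/-- The leading term of the Leibniz rule. -/
theorem iteratedDeriv_mul_sub_mem_jetSpan {u : ℝ → ℂ} (hu : ContDiff ℝ ∞ u) {n k : ℕ}
    (hk : k ≤ n) (x : ℝ) :
    (fun f => iteratedDeriv k (u * f.1) x - u x * iteratedDeriv k f.1 x) ∈ jetSpan n x := by
  have h : (fun f : {f : ℝ → ℂ // ContDiff ℝ ∞ f} =>
      iteratedDeriv k (u * f.1) x - u x * iteratedDeriv k f.1 x) =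
      ∑ i ∈ Finset.range k, (k.choose (i + 1) * iteratedDeriv (i + 1) u x) •
        fun f : {f : ℝ → ℂ // ContDiff ℝ ∞ f} => iteratedDeriv (k - (i + 1)) f.1 x := by
    ext f
    have hle : ((k : ℕ) : WithTop ℕ∞) ≤ ∞ := by exact_mod_cast le_top
    rw [iteratedDeriv_mul (hu.of_le hle).contDiffAt (f.2.of_le hle).contDiffAt,
      Finset.sum_range_succ']
    simp
  rw [h]
  refine Submodule.sum_mem _ fun i hi => Submodule.smul_mem _ _ (iteratedDeriv_mem_jetSpan ?_ x)
  have := Finset.mem_range.1 hi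
  omega

theorem hasDerivAt_monicDiffOp {n : ℕ} {a : Fin n → ℝ → ℂ} (ha : ∀ k, ContDiff ℝ ∞ (a k))
    {f : ℝ → ℂ} (hf : ContDiff ℝ ∞ f) (x : ℝ) :
    HasDerivAt (monicDiffOp a f) (iteratedDeriv (n + 1) f x + ∑ k : Fin n,
      (deriv (a k) x * iteratedDeriv (k : ℕ) f x +
        a k x * iteratedDeriv ((k : ℕ) + 1) f x)) x :=
  (hf.hasDerivAt_iteratedDeriv n x).add (HasDerivAt.fun_sum fun k _ =>
    (((ha k).differentiable (by simp)).differentiableAt.hasDerivAt).mul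
      (hf.hasDerivAt_iteratedDeriv k x))

theorem deriv_deriv_monicDiffOp {n : ℕ} {a : Fin n → ℝ → ℂ} (ha : ∀ k, ContDiff ℝ ∞ (a k))
    {f : ℝ → ℂ} (hf : ContDiff ℝ ∞ f) (x : ℝ) :
    deriv (deriv (monicDiffOp a f)) x = iteratedDeriv (n + 2) f x + ∑ k : Fin n,
      (deriv (deriv (a k)) x * iteratedDeriv (k : ℕ) f x +
        2 * (deriv (a k) x * iteratedDeriv ((k : ℕ) + 1) f x) +
        a k x * iteratedDeriv ((k : ℕ) + 2) f x) := by
  rw [funext fun t => (hasDerivAt_monicDiffOp ha hf t).deriv]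
  have h : HasDerivAt (fun t => iteratedDeriv (n + 1) f t + ∑ k : Fin n,
      (deriv (a k) t * iteratedDeriv (k : ℕ) f t + a k t * iteratedDeriv ((k : ℕ) + 1) f t)) _ x :=
    (hf.hasDerivAt_iteratedDeriv (n + 1) x).add (HasDerivAt.fun_sum fun k _ =>
      (((((contDiff_infty_iff_deriv.1 (ha k)).2).differentiable
        (by simp)).differentiableAt.hasDerivAt).mul (hf.hasDerivAt_iteratedDeriv k x)).add
      ((((ha k).differentiable (by simp)).differentiableAt.hasDerivAt).mul
        (hf.hasDerivAt_iteratedDeriv (k + 1) x)))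
  rw [h.deriv]
  congr 1
  exact Finset.sum_congr rfl fun k _ => by ring

theorem monicDiffOp_schrodinger {n : ℕ} (a : Fin n → ℝ → ℂ) {u f : ℝ → ℂ} (hu : ContDiff ℝ ∞ u)
    (hf : ContDiff ℝ ∞ f) (x : ℝ) :
    monicDiffOp a (deriv (deriv f) - u * f) x =
      iteratedDeriv (n + 2) f x - iteratedDeriv n (u * f) x + ∑ k : Fin n,
        a k x * (iteratedDeriv ((k : ℕ) + 2) f x - iteratedDeriv (k : ℕ) (u * f) x) := by
  have h : ∀ k, iteratedDeriv k (deriv (deriv f) - u * f) x =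
      iteratedDeriv (k + 2) f x - iteratedDeriv k (u * f) x := by
    intro k
    have hle : ((k : ℕ) : WithTop ℕ∞) ≤ ∞ := by exact_mod_cast le_top
    have hf'' : ContDiff ℝ ∞ (deriv (deriv f)) := hf.iterate_deriv 2
    rw [iteratedDeriv_sub (hf''.of_le hle).contDiffAt (ContDiff.of_le (f := u * f) (hu.mul hf) hle).contDiffAt,
      iteratedDeriv_succ', iteratedDeriv_succ']
  simp only [monicDiffOp, h]

/-- If `s` is chosen to cancel the term of order `n`, the commutator defect between `D² - u` and
`D² - u + 2 s` under the operator `monicDiffOp a` has order less than `n`. -/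
theorem intertwining_defect_mem_jetSpan {n : ℕ} {a : Fin n → ℝ → ℂ}
    (ha : ∀ k, ContDiff ℝ ∞ (a k)) {u : ℝ → ℂ} (hu : ContDiff ℝ ∞ u) {x : ℝ} {s : ℂ}
    (hs : (fun f => ∑ k : Fin n, deriv (a k) x * iteratedDeriv ((k : ℕ) + 1) f.1 x +
      s * iteratedDeriv n f.1 x) ∈ jetSpan n x) :
    (fun f => monicDiffOp a (deriv (deriv f.1) - u * f.1) x - deriv (deriv (monicDiffOp a f.1)) x -
      (2 * s - u x) * monicDiffOp a f.1 x) ∈ jetSpan n x := by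
  have h1 := iteratedDeriv_mul_sub_mem_jetSpan hu le_rfl x (n := n)
  have h2 := Submodule.sum_mem (jetSpan n x) (t := Finset.univ) fun (k : Fin n) _ =>
    Submodule.smul_mem _ (a k x) (iteratedDeriv_mul_sub_mem_jetSpan hu k.2.le x)
  have h3 := Submodule.sum_mem (jetSpan n x) (t := Finset.univ) fun (k : Fin n) _ =>
    Submodule.smul_mem _ (deriv (deriv (a k)) x + 2 * s * a k x) (iteratedDeriv_mem_jetSpan k.2 x)
  convert Submodule.neg_mem _ (Submodule.add_mem _ (Submodule.add_mem _
    (Submodule.add_mem _ h1 h2) h3) (Submodule.smul_mem _ 2 hs)) using 1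
  ext f
  rw [monicDiffOp_schrodinger a hu f.2, deriv_deriv_monicDiffOp ha f.2]
  simp only [monicDiffOp, Pi.neg_apply, Pi.add_apply, Finset.sum_apply, Pi.smul_apply, smul_eq_mul,
    mul_add, mul_sub, add_mul, Finset.sum_add_distrib, Finset.sum_sub_distrib, Finset.mul_sum]
  simp only [mul_assoc, sub_mul, mul_left_comm (u x), Finset.sum_sub_distrib]
  ring

theorem eq_zero_of_mem_jetSpan {n : ℕ} {Y : Fin n → ℝ → ℂ} (hY : ∀ j, ContDiff ℝ ∞ (Y j)) {x : ℝ}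
    (hW : wronskian Y x ≠ 0) {E : {f : ℝ → ℂ // ContDiff ℝ ∞ f} → ℂ} (hE : E ∈ jetSpan n x)
    (h : ∀ j, E ⟨Y j, hY j⟩ = 0) : E = 0 := by
  obtain ⟨c, rfl⟩ := (Submodule.mem_span_range_iff_exists_fun ℂ).1 hE
  have hc : c = 0 := by
    refine Matrix.eq_zero_of_vecMul_eq_zero (M := wronskianMatrix Y x) hW ?_
    ext j
    simpa [Matrix.vecMul, dotProduct, wronskianMatrix] using h j
  simp [hc]

theorem monicDiffOp_const_mul {n : ℕ} (a : Fin n → ℝ → ℂ) (c : ℂ) (f : ℝ → ℂ) (x : ℝ) :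
    monicDiffOp a (fun t => c * f t) x = c * monicDiffOp a f x := by
  simp only [monicDiffOp, iteratedDeriv_const_mul_field, mul_add, Finset.mul_sum, mul_left_comm]

theorem monicDiffOp_schrodinger_eigenfunction {n : ℕ} (a : Fin n → ℝ → ℂ) {u f : ℝ → ℂ} {μ : ℂ}
    (hf : ∀ x, deriv (deriv f) x + (μ - u x) * f x = 0) (x : ℝ) :
    monicDiffOp a (deriv (deriv f) - u * f) x = -μ * monicDiffOp a f x := by
  rw [← monicDiffOp_const_mul]
  congr 1
  ext t
  simp only [Pi.sub_apply, Pi.mul_apply]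
  linear_combination hf t

/-- The second coefficient of the annihilating operator being minus the logarithmic derivative of
the Wronskian, the term of order `n` cancels. -/
theorem logDeriv_wronskian_mem_jetSpan {n : ℕ} {Y : Fin n → ℝ → ℂ}
    (hY : ∀ j, ContDiff ℝ ∞ (Y j)) (hW : ∀ x, wronskian Y x ≠ 0) (x : ℝ) :
    (fun f => ∑ k : Fin n, deriv (annihilatorCoeff Y k) x * iteratedDeriv ((k : ℕ) + 1) f.1 x +
      deriv (fun t => deriv (wronskian Y) t / wronskian Y t) x * iteratedDeriv n f.1 x)
      ∈ jetSpan n x := by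
  cases n with
  | zero =>
    have h : wronskian Y = fun _ => 1 := by
      ext t
      exact Matrix.det_isEmpty
    simp only [h, deriv_const', zero_div, zero_mul, Finset.univ_eq_empty, Finset.sum_empty, add_zero]
    exact Submodule.zero_mem (jetSpan 0 x)
  | succ m =>
    have h : (fun t => deriv (wronskian Y) t / wronskian Y t) =
        fun t => -annihilatorCoeff Y (Fin.last m) t := by
      ext t
      rw [deriv_wronskian hY fun j => monicDiffOp_annihilatorCoeff (hW t) j,
        mul_div_cancel_right₀ _ (hW t)]
    have h' := Submodule.sum_mem (jetSpan (m + 1) x) (t := Finset.univ) fun (k : Fin m) _ =>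
      Submodule.smul_mem _ (deriv (annihilatorCoeff Y k.castSucc) x)
        (iteratedDeriv_mem_jetSpan (Nat.succ_lt_succ k.2) x)
    convert h' using 1
    ext f
    rw [h, deriv.fun_neg, Fin.sum_univ_castSucc]
    simp

/-- **Crum's theorem**: after `n` Darboux transformations, the function
`y⁽ⁿ⁾ = W[y₁,…,yₙ,y]/W[y₁,…,yₙ]` satisfies the Sturm–Liouville equation with
potential `u⁽ⁿ⁾ = u − 2 (W[y₁,…,yₙ]'/W[y₁,…,yₙ])'`. -/
theorem crum_theorem
    (n : ℕ) (u : ℝ → ℂ) (hu : ContDiff ℝ (⊤ : ℕ∞) u)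
    (lam : ℂ) (lams : Fin n → ℂ)
    (y : ℝ → ℂ) (Y : Fin n → ℝ → ℂ)
    (hy : ContDiff ℝ (⊤ : ℕ∞) y) (hY : ∀ j, ContDiff ℝ (⊤ : ℕ∞) (Y j))
    (heq : ∀ x, deriv (deriv y) x + (lam - u x) * y x = 0)
    (heqY : ∀ j x, deriv (deriv (Y j)) x + (lams j - u x) * Y j x = 0)
    (hW : ∀ x, wronskian Y x ≠ 0) :
    ∀ x, deriv (deriv (fun t => wronskian (Fin.snoc Y y) t / wronskian Y t)) x
        + (lam - (u x - 2 * deriv (fun t => deriv (wronskian Y) t / wronskian Y t) x))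
          * (wronskian (Fin.snoc Y y) x / wronskian Y x) = 0 := by
  intro x
  have hL : ∀ t j, monicDiffOp (annihilatorCoeff Y) (Y j) t = 0 := fun t j =>
    monicDiffOp_annihilatorCoeff (hW t) j
  have hquot : (fun t => wronskian (Fin.snoc Y y) t / wronskian Y t) =
      monicDiffOp (annihilatorCoeff Y) y := by
    ext t
    rw [wronskian_snoc (hL t), mul_div_cancel_left₀ _ (hW t)]
  have hE := eq_zero_of_mem_jetSpan hY (hW x) (intertwining_defect_mem_jetSpan
    (contDiff_annihilatorCoeff hY hW) hu (logDeriv_wronskian_mem_jetSpan hY hW x)) fun j => by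
      have h0 : monicDiffOp (annihilatorCoeff Y) (Y j) = fun _ => 0 := funext fun t => hL t j
      simp only [monicDiffOp_schrodinger_eigenfunction _ (heqY j), h0]
      simp
  have hEy := congrFun hE ⟨y, hy⟩
  simp only [monicDiffOp_schrodinger_eigenfunction _ heq, Pi.zero_apply] at hEy
  rw [hquot, congrFun hquot x]
  linear_combination -hEy
end

section
/- Let α₁, α₂, u, u₁, u₂, U be real numbers with α₁ ≠ α₂ such that α₁·( sin((u₁−u)/2) + sin((U−u₂)/2) ) = α₂·( sin((u₂−u)/2) + sin((U−u₁)/2) ). Assume the nondegeneracy conditions cos((U + u − u₁ − u₂)/4) ≠ 0, cos((U−u)/4) ≠ 0 and cos((u₁−u₂)/4) ≠ 0. Then tan((U−u)/4) = ((α₁+α₂)/(α₂−α₁))·tan((u₁−u₂)/4); equivalently, U satisfies the nonlinear superposition formula U = u + 4·arctan-branch of ((α₁+α₂)/(α₂−α₁))·tan((u₁−u₂)/4). -/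
/-- If `α₁ sin (a + b) = α₂ sin (a - b)` then `tan a` and `tan b` are proportional. -/
theorem tan_eq_div_mul_tan_of_mul_sin_add_eq_mul_sin_sub {α₁ α₂ a b : ℝ} (hα : α₁ ≠ α₂)
    (h : α₁ * Real.sin (a + b) = α₂ * Real.sin (a - b))
    (ha : Real.cos a ≠ 0) (hb : Real.cos b ≠ 0) :
    Real.tan a = ((α₁ + α₂) / (α₂ - α₁)) * Real.tan b := by
  have hα' : α₂ - α₁ ≠ 0 := sub_ne_zero.mpr hα.symm
  rw [Real.sin_add, Real.sin_sub] at h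
  rw [Real.tan_eq_sin_div_cos, Real.tan_eq_sin_div_cos, div_mul_div_comm,
    div_eq_div_iff ha (mul_ne_zero hα' hb)]
  linear_combination -h

/-- **Bianchi permutability for sine-Gordon** (algebraic content): from the sine
identity obtained by eliminating derivatives from the four Bäcklund relations, and
the nondegeneracy conditions, the nonlinear superposition formula
`tan((U−u)/4) = ((α₁+α₂)/(α₂−α₁))·tan((u₁−u₂)/4)` follows. -/
theorem sineGordon_superposition
    (α₁ α₂ u u₁ u₂ U : ℝ) (hα : α₁ ≠ α₂)
    (hsin : α₁ * (Real.sin ((u₁ - u) / 2) + Real.sin ((U - u₂) / 2))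
          = α₂ * (Real.sin ((u₂ - u) / 2) + Real.sin ((U - u₁) / 2)))
    (hc1 : Real.cos ((U + u - u₁ - u₂) / 4) ≠ 0)
    (hc2 : Real.cos ((U - u) / 4) ≠ 0)
    (hc3 : Real.cos ((u₁ - u₂) / 4) ≠ 0) :
    Real.tan ((U - u) / 4) = ((α₁ + α₂) / (α₂ - α₁)) * Real.tan ((u₁ - u₂) / 4) := by
  refine tan_eq_div_mul_tan_of_mul_sin_add_eq_mul_sin_sub hα ?_ hc2 hc3
  have sin_sub_add_sin_add (x y : ℝ) :
      Real.sin (x - y) + Real.sin (x + y) = 2 * Real.sin x * Real.cos y := by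
    rw [Real.sin_sub, Real.sin_add]
    ring
  have h₁ := sin_sub_add_sin_add ((U - u) / 4 + (u₁ - u₂) / 4) ((U + u - u₁ - u₂) / 4)
  have h₂ := sin_sub_add_sin_add ((U - u) / 4 - (u₁ - u₂) / 4) ((U + u - u₁ - u₂) / 4)
  rw [show (U - u) / 4 + (u₁ - u₂) / 4 - (U + u - u₁ - u₂) / 4 = (u₁ - u) / 2 by ring,
    show (U - u) / 4 + (u₁ - u₂) / 4 + (U + u - u₁ - u₂) / 4 = (U - u₂) / 2 by ring] at h₁
  rw [show (U - u) / 4 - (u₁ - u₂) / 4 - (U + u - u₁ - u₂) / 4 = (u₂ - u) / 2 by ring,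
    show (U - u) / 4 - (u₁ - u₂) / 4 + (U + u - u₁ - u₂) / 4 = (U - u₁) / 2 by ring] at h₂
  rw [h₁, h₂] at hsin
  apply mul_right_cancel₀ hc1
  linear_combination hsin / 2
end

section
/- Let α₁, α₂ ∈ ℝ and let u, u₁, u₂, U : ℝ → ℝ be differentiable functions satisfying, for all x, the Bäcklund relations (u₁+u)'(x) = 2α₁ + (1/2)(u₁(x)−u(x))², (u₂+u)'(x) = 2α₂ + (1/2)(u₂(x)−u(x))², (U+u₁)'(x) = 2α₂ + (1/2)(U(x)−u₁(x))², and (U+u₂)'(x) = 2α₁ + (1/2)(U(x)−u₂(x))². If u₁(x) ≠ u₂(x), then U(x) = u(x) − 4(α₁−α₂)/(u₁(x)−u₂(x)). -/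
/-- **Bianchi permutability for the potential KdV equation**: if `u₁ = B_{α₁}(u)`,
`u₂ = B_{α₂}(u)`, `U = B_{α₂}(u₁) = B_{α₁}(u₂)` via the spatial Bäcklund relations
`(u+v)_x = 2α + (1/2)(u−v)²`, then `U = u − 4(α₁−α₂)/(u₁−u₂)` wherever `u₁ ≠ u₂`. -/
theorem pKdV_superposition
    (α₁ α₂ : ℝ) (u u₁ u₂ U : ℝ → ℝ)
    (hu : Differentiable ℝ u) (hu₁ : Differentiable ℝ u₁)
    (hu₂ : Differentiable ℝ u₂) (hU : Differentiable ℝ U)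
    (h1 : ∀ x, deriv (fun t => u₁ t + u t) x = 2 * α₁ + (1 / 2) * (u₁ x - u x) ^ 2)
    (h2 : ∀ x, deriv (fun t => u₂ t + u t) x = 2 * α₂ + (1 / 2) * (u₂ x - u x) ^ 2)
    (h3 : ∀ x, deriv (fun t => U t + u₁ t) x = 2 * α₂ + (1 / 2) * (U x - u₁ x) ^ 2)
    (h4 : ∀ x, deriv (fun t => U t + u₂ t) x = 2 * α₁ + (1 / 2) * (U x - u₂ x) ^ 2)
    (x : ℝ) (hne : u₁ x ≠ u₂ x) :
    U x = u x - 4 * (α₁ - α₂) / (u₁ x - u₂ x) := by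
  have h1x := h1 x
  have h2x := h2 x
  have h3x := h3 x
  have h4x := h4 x
  rw [deriv_fun_add (hu₁ x) (hu x)] at h1x
  rw [deriv_fun_add (hu₂ x) (hu x)] at h2x
  rw [deriv_fun_add (hU x) (hu₁ x)] at h3x
  rw [deriv_fun_add (hU x) (hu₂ x)] at h4x
  have hsub : u₁ x - u₂ x ≠ 0 := sub_ne_zero.mpr hne
  rw [eq_sub_iff_add_eq', ← eq_sub_iff_add_eq, div_eq_iff hsub]
  linear_combination h3x - h4x - h1x + h2x
end

section
/- Let f, p, q, p₁₀, q₁₀ : ℝ → ℂ with f, p, q₁₀ differentiable. For λ ∈ ℂ define the 2×2 complex matrices U(r,s;λ) = λ·!![1,0;0,−1] + !![0,2r;2s,0] and M(x;λ) = λ·!![1,0;0,0] + !![f(x), p(x); q₁₀(x), 1]. Then M satisfies the Darboux equation ∂ₓM(x;λ) + U(p₁₀(x),q₁₀(x);λ)·M(x;λ) − M(x;λ)·U(p(x),q(x);λ) = 0 for all x ∈ ℝ and all λ ∈ ℂ if and only if the differential-difference system f'(x) = 2(p(x)q(x) − p₁₀(x)q₁₀(x)), p'(x) = 2(p(x)f(x)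 − p₁₀(x)), q₁₀'(x) = 2(q(x) − q₁₀(x)f(x)) holds for all x. -/
/-- The non-differential part of the NLS Lax operator:
`U(r,s;λ) = λ·diag(1,−1) + !![0,2r;2s,0]`. -/
noncomputable def UmatNLS (r s lam : ℂ) : Matrix (Fin 2) (Fin 2) ℂ :=
  lam • !![1, 0; 0, -1] + !![0, 2 * r; 2 * s, 0]

/-- The linear-in-`λ` Darboux matrix for NLS:
`M(x;λ) = λ·!![1,0;0,0] + !![f, p; q₁₀, 1]`. -/
noncomputable def MmatNLS (f p q₁₀ lam : ℂ) : Matrix (Fin 2) (Fin 2) ℂ :=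
  lam • !![1, 0; 0, 0] + !![f, p; q₁₀, 1]

/-- The entrywise derivative of the Darboux matrix. -/
theorem deriv_MmatNLS (f p q₁₀ : ℝ → ℂ) (x : ℝ) (lam : ℂ) :
    (Matrix.of fun i j : Fin 2 => deriv (fun t => MmatNLS (f t) (p t) (q₁₀ t) lam i j) x)
      = !![deriv f x, deriv p x; deriv q₁₀ x, 0] := by
  ext i j
  fin_cases i <;> fin_cases j <;> simp [MmatNLS]

/-- The left-hand side of the Darboux equation is independent of `lam`: the spectral parameter
cancels from every entry. -/
theorem darboux_NLS_residual (f p q p₁₀ q₁₀ : ℝ → ℂ) (x : ℝ) (lam : ℂ) :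
    (Matrix.of fun i j : Fin 2 =>
        deriv (fun t => MmatNLS (f t) (p t) (q₁₀ t) lam i j) x)
      + UmatNLS (p₁₀ x) (q₁₀ x) lam * MmatNLS (f x) (p x) (q₁₀ x) lam
      - MmatNLS (f x) (p x) (q₁₀ x) lam * UmatNLS (p x) (q x) lam
    = !![deriv f x - 2 * (p x * q x - p₁₀ x * q₁₀ x), deriv p x - 2 * (p x * f x - p₁₀ x);
        deriv q₁₀ x - 2 * (q x - q₁₀ x * f x), 0] := by
  rw [deriv_MmatNLS]
  ext i j
  fin_cases i <;> fin_cases j <;> simp [MmatNLS, UmatNLS] <;> ring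

/-- `M(x;λ) = λ·!![1,0;0,0] + !![f,p;q₁₀,1]` satisfies the Darboux equation
`∂ₓM + U(p₁₀,q₁₀;λ)·M − M·U(p,q;λ) = 0` for all `x` and `λ` if and only if the
differential-difference system `f' = 2(pq − p₁₀q₁₀)`, `p' = 2(pf − p₁₀)`,
`q₁₀' = 2(q − q₁₀f)` holds. -/
theorem darboux_equation_NLS_iff
    (f p q p₁₀ q₁₀ : ℝ → ℂ)
    (hf : Differentiable ℝ f) (hp : Differentiable ℝ p) (hq₁₀ : Differentiable ℝ q₁₀) :
    (∀ (x : ℝ) (lam : ℂ),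
        (Matrix.of fun i j : Fin 2 =>
            deriv (fun t => MmatNLS (f t) (p t) (q₁₀ t) lam i j) x)
          + UmatNLS (p₁₀ x) (q₁₀ x) lam * MmatNLS (f x) (p x) (q₁₀ x) lam
          - MmatNLS (f x) (p x) (q₁₀ x) lam * UmatNLS (p x) (q x) lam = 0)
    ↔ (∀ x : ℝ,
        deriv f x = 2 * (p x * q x - p₁₀ x * q₁₀ x) ∧
        deriv p x = 2 * (p x * f x - p₁₀ x) ∧
        deriv q₁₀ x = 2 * (q x - q₁₀ x * f x)) := by
  simp only [darboux_NLS_residual]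
  constructor
  · intro h x
    have hx := h x 0
    exact ⟨sub_eq_zero.mp (congrFun (congrFun hx 0) 0),
      sub_eq_zero.mp (congrFun (congrFun hx 0) 1), sub_eq_zero.mp (congrFun (congrFun hx 1) 0)⟩
  · intro h x _
    obtain ⟨h₁, h₂, h₃⟩ := h x
    ext i j
    fin_cases i <;> fin_cases j <;> simp [h₁, h₂, h₃]
end

section
/- Let c₁, c₂ ∈ ℂ and let f, p, q, p₁₀, q₁₀ : ℝ → ℂ with f, p, q₁₀ differentiable and f(x) ≠ 0 for all x. For λ ∈ ℂ define the 2×2 complex matrices U(r,s;λ) = λ²·!![1,0;0,−1] + λ·!![0,2r;2s,0] and M(x;λ) = λ²·!![f(x),0;0,0] + λ·!![0, f(x)p(x); f(x)q₁₀(x), 0] + !![c₁,0;0,c₂]. Then M satisfies the Darboux equation ∂ₓM(x;λ) + U(p₁₀(x),q₁₀(x);λ)·M(x;λ) − M(x;λ)·U(p(x),q(x);λ) = 0 for all x and all λ if and only if for all x: f' = 2f(pq − p₁₀q₁₀), p' = 2p(p₁₀q₁₀ − pq) − 2(c₂p₁₀ − c₁p)/f, and q₁₀' = 2q₁₀(p₁₀q₁₀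 − pq) − 2(c₁q₁₀ − c₂q)/f. -/
/-- The non-differential part of the DNLS Lax operator:
`U(r,s;λ) = λ²·diag(1,−1) + λ·!![0,2r;2s,0]`. -/
noncomputable def UmatDNLS (r s lam : ℂ) : Matrix (Fin 2) (Fin 2) ℂ :=
  lam ^ 2 • !![1, 0; 0, -1] + lam • !![0, 2 * r; 2 * s, 0]

/-- The `ℤ₂`-invariant Darboux matrix for DNLS:
`M(x;λ) = λ²·!![f,0;0,0] + λ·!![0,fp;fq₁₀,0] + !![c₁,0;0,c₂]`. -/
noncomputable def MmatDNLS (f p q₁₀ c₁ c₂ lam : ℂ) : Matrix (Fin 2) (Fin 2) ℂ :=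
  lam ^ 2 • !![f, 0; 0, 0] + lam • !![0, f * p; f * q₁₀, 0] + !![c₁, 0; 0, c₂]

/-- The left-hand side of the Darboux equation, computed entrywise. -/
theorem darboux_lhs_DNLS (c₁ c₂ p₁₀ q lam : ℂ) {f p q₁₀ : ℝ → ℂ} {x : ℝ}
    (hf : DifferentiableAt ℝ f x) (hp : DifferentiableAt ℝ p x)
    (hq₁₀ : DifferentiableAt ℝ q₁₀ x) :
    (Matrix.of fun i j : Fin 2 =>
        deriv (fun t => MmatDNLS (f t) (p t) (q₁₀ t) c₁ c₂ lam i j) x)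
      + UmatDNLS p₁₀ (q₁₀ x) lam * MmatDNLS (f x) (p x) (q₁₀ x) c₁ c₂ lam
      - MmatDNLS (f x) (p x) (q₁₀ x) c₁ c₂ lam * UmatDNLS (p x) q lam
    = !![lam ^ 2 * (deriv f x - 2 * f x * (p x * q - p₁₀ * q₁₀ x)),
        lam * (deriv f x * p x + f x * deriv p x + 2 * (c₂ * p₁₀ - c₁ * p x));
        lam * (deriv f x * q₁₀ x + f x * deriv q₁₀ x + 2 * (c₁ * q₁₀ x - c₂ * q)), 0] := by
  have hfp : deriv (fun t => f t * p t) x = deriv f x * p x + f x * deriv p x :=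
    deriv_fun_mul hf hp
  have hfq : deriv (fun t => f t * q₁₀ t) x = deriv f x * q₁₀ x + f x * deriv q₁₀ x :=
    deriv_fun_mul hf hq₁₀
  have hM : (Matrix.of fun i j : Fin 2 =>
        deriv (fun t => MmatDNLS (f t) (p t) (q₁₀ t) c₁ c₂ lam i j) x)
      = !![lam ^ 2 * deriv f x, lam * (deriv f x * p x + f x * deriv p x);
          lam * (deriv f x * q₁₀ x + f x * deriv q₁₀ x), 0] := by
    ext i j
    fin_cases i <;> fin_cases j <;> simp [MmatDNLS, hfp, hfq]
  rw [hM]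
  ext i j
  fin_cases i <;> fin_cases j <;> simp [UmatDNLS, MmatDNLS] <;> ring

/-- `M` satisfies the Darboux equation `∂ₓM + U(p₁₀,q₁₀;λ)·M − M·U(p,q;λ) = 0` for
all `x` and all `λ` if and only if the differential-difference system
`f' = 2f(pq − p₁₀q₁₀)`, `p' = 2p(p₁₀q₁₀ − pq) − 2(c₂p₁₀ − c₁p)/f`,
`q₁₀' = 2q₁₀(p₁₀q₁₀ − pq) − 2(c₁q₁₀ − c₂q)/f` holds. -/
theorem darboux_equation_DNLS_iff
    (c₁ c₂ : ℂ) (f p q p₁₀ q₁₀ : ℝ → ℂ)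
    (hf : Differentiable ℝ f) (hp : Differentiable ℝ p) (hq₁₀ : Differentiable ℝ q₁₀)
    (hfne : ∀ x, f x ≠ 0) :
    (∀ (x : ℝ) (lam : ℂ),
        (Matrix.of fun i j : Fin 2 =>
            deriv (fun t => MmatDNLS (f t) (p t) (q₁₀ t) c₁ c₂ lam i j) x)
          + UmatDNLS (p₁₀ x) (q₁₀ x) lam * MmatDNLS (f x) (p x) (q₁₀ x) c₁ c₂ lam
          - MmatDNLS (f x) (p x) (q₁₀ x) c₁ c₂ lam * UmatDNLS (p x) (q x) lam = 0)
    ↔ (∀ x : ℝ,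
        deriv f x = 2 * f x * (p x * q x - p₁₀ x * q₁₀ x) ∧
        deriv p x = 2 * p x * (p₁₀ x * q₁₀ x - p x * q x)
          - 2 * (c₂ * p₁₀ x - c₁ * p x) / f x ∧
        deriv q₁₀ x = 2 * q₁₀ x * (p₁₀ x * q₁₀ x - p x * q x)
          - 2 * (c₁ * q₁₀ x - c₂ * q x) / f x) := by
  simp only [darboux_lhs_DNLS c₁ c₂ _ _ _ (hf _) (hp _) (hq₁₀ _)]
  refine forall_congr' fun x => ?_
  have hx := hfne x
  constructor
  · intro h
    have h₁ := h 1
    simp only [← Matrix.ext_iff, Fin.forall_fin_two] at h₁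
    simp at h₁
    obtain ⟨⟨h_f, h_p⟩, h_q⟩ := h₁
    refine ⟨by linear_combination h_f, ?_, ?_⟩
    · field_simp
      linear_combination h_p - p x * h_f
    · field_simp
      linear_combination h_q - q₁₀ x * h_f
  · rintro ⟨h_f, h_p, h_q⟩ lam
    field_simp at h_p h_q
    ext i j
    fin_cases i <;> fin_cases j
    · simp [h_f]
    · simp
      right
      linear_combination h_p + p x * h_f
    · simp
      right
      linear_combination h_q + q₁₀ x * h_f
    · simp
end

section
/- Let c₁, c₂ ∈ ℂ and let f, p, q, p₁₀, q₁₀ : ℝ → ℂ with f, p, q₁₀ differentiable, f nowhere vanishing, and suppose that for all x: f' = 2f(pq − p₁₀q₁₀), p' = 2p(p₁₀q₁₀ − pq) − 2(c₂p₁₀ − c₁p)/f, and q₁₀' = 2q₁₀(p₁₀q₁₀ − pq) − 2(c₁q₁₀ − c₂q)/f. Then the quantity f²·p·q₁₀ − c₂·f is a first integral: the derivative of x ↦ f(x)²·p(x)·q₁₀(x) − c₂·f(x) vanishes identically. -/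
/-- The quantity `f²·p·q₁₀ − c₂·f` is a first integral of the differential-difference
system arising from the DNLS Darboux matrix: its derivative vanishes identically. -/
theorem DNLS_first_integral
    (c₁ c₂ : ℂ) (f p q p₁₀ q₁₀ : ℝ → ℂ)
    (hf : Differentiable ℝ f) (hp : Differentiable ℝ p) (hq₁₀ : Differentiable ℝ q₁₀)
    (hfne : ∀ x, f x ≠ 0)
    (h1 : ∀ x, deriv f x = 2 * f x * (p x * q x - p₁₀ x * q₁₀ x))
    (h2 : ∀ x, deriv p x = 2 * p x * (p₁₀ x * q₁₀ x - p x * q x)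
        - 2 * (c₂ * p₁₀ x - c₁ * p x) / f x)
    (h3 : ∀ x, deriv q₁₀ x = 2 * q₁₀ x * (p₁₀ x * q₁₀ x - p x * q x)
        - 2 * (c₁ * q₁₀ x - c₂ * q x) / f x) :
    ∀ x, deriv (fun t => f t ^ 2 * p t * q₁₀ t - c₂ * f t) x = 0 := by
  intro x
  have hd := ((((hf x).hasDerivAt.fun_pow 2).fun_mul (hp x).hasDerivAt).fun_mul
    (hq₁₀ x).hasDerivAt).fun_sub ((hf x).hasDerivAt.const_mul c₂)
  rw [hd.deriv, h1, h2, h3]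
  have := hfne x
  push_cast
  field_simp
  ring
end

section
/- Let p, q, p₁₀, q₁₀, f, g : ℝ → ℂ be differentiable functions satisfying, for all x, the system: p' = 2((p₁₀q₁₀ − pq)p + (p − p₁₀)g + q − q₁₀), q₁₀' = 2((p₁₀q₁₀ − pq)q₁₀ + (q − q₁₀)g + p − p₁₀), g' = 2((p₁₀q₁₀ − pq)g + (p − p₁₀)p + (q − q₁₀)q₁₀), and f' = 2(pq − p₁₀q₁₀)f. Then Φ₁ = f²·(g − p·q₁₀) and Φ₂ = f²·(g² + 1 − p² − q₁₀²) are first integrals: the derivatives of x ↦ Φ₁(x) and x ↦ Φ₂(x) vanish identically. Moreover, for every λ ∈ ℂ with λ ≠ 0 and every x, the determinant of the Darboux matrix M(x;λ) = f(x)·( !![λ²,0;0,λ⁻²] + λ·!![0,p(x);q₁₀(x),0] + g(x)·I + λ⁻¹·!![0,q₁₀(x);p(x),0] ) equals (λ² + λ⁻²)·Φ₁(x) + Φ₂(x), so det M is constant in x. -/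
/-- The determinant of the dihedral Darboux matrix, expanded in powers of `lam`. -/
theorem det_dihedral_darboux (a b c d lam : ℂ) (hlam : lam ≠ 0) :
    (d • (!![lam ^ 2, 0; 0, (lam⁻¹) ^ 2]
        + lam • !![0, a; b, 0]
        + c • (1 : Matrix (Fin 2) (Fin 2) ℂ)
        + lam⁻¹ • !![0, b; a, 0])).det
      = (lam ^ 2 + (lam⁻¹) ^ 2) * (d ^ 2 * (c - a * b))
        + d ^ 2 * (c ^ 2 + 1 - a ^ 2 - b ^ 2) := by
  rw [Matrix.det_fin_two]
  simp
  field_simp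
  ring

/-- For the deformation of the DNLS equation, the quantities
`Φ₁ = f²(g − p·q₁₀)` and `Φ₂ = f²(g² + 1 − p² − q₁₀²)` are first integrals of the
differential-difference system, and the determinant of the dihedral Darboux matrix
`M(x;λ) = f·( diag(λ²,λ⁻²) + λ·!![0,p;q₁₀,0] + g·I + λ⁻¹·!![0,q₁₀;p,0] )` equals
`(λ² + λ⁻²)·Φ₁ + Φ₂`; in particular `det M` is constant in `x`. -/
theorem deformation_DNLS_first_integrals_det
    (p q p₁₀ q₁₀ f g : ℝ → ℂ)
    (hp : Differentiable ℝ p) (hq₁₀ : Differentiable ℝ q₁₀)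
    (hf : Differentiable ℝ f) (hg : Differentiable ℝ g)
    (h1 : ∀ x, deriv p x = 2 * ((p₁₀ x * q₁₀ x - p x * q x) * p x
        + (p x - p₁₀ x) * g x + q x - q₁₀ x))
    (h2 : ∀ x, deriv q₁₀ x = 2 * ((p₁₀ x * q₁₀ x - p x * q x) * q₁₀ x
        + (q x - q₁₀ x) * g x + p x - p₁₀ x))
    (h3 : ∀ x, deriv g x = 2 * ((p₁₀ x * q₁₀ x - p x * q x) * g x
        + (p x - p₁₀ x) * p x + (q x - q₁₀ x) * q₁₀ x))
    (h4 : ∀ x, deriv f x = 2 * (p x * q x - p₁₀ x * q₁₀ x) * f x) :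
    (∀ x, deriv (fun t => f t ^ 2 * (g t - p t * q₁₀ t)) x = 0) ∧
    (∀ x, deriv (fun t => f t ^ 2 * (g t ^ 2 + 1 - p t ^ 2 - q₁₀ t ^ 2)) x = 0) ∧
    (∀ (lam : ℂ), lam ≠ 0 → ∀ x : ℝ,
        (f x • (!![lam ^ 2, 0; 0, (lam⁻¹) ^ 2]
            + lam • !![0, p x; q₁₀ x, 0]
            + g x • (1 : Matrix (Fin 2) (Fin 2) ℂ)
            + lam⁻¹ • !![0, q₁₀ x; p x, 0])).det
          = (lam ^ 2 + (lam⁻¹) ^ 2) * (f x ^ 2 * (g x - p x * q₁₀ x))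
            + f x ^ 2 * (g x ^ 2 + 1 - p x ^ 2 - q₁₀ x ^ 2)) ∧
    (∀ (lam : ℂ), lam ≠ 0 → ∀ x y : ℝ,
        (f x • (!![lam ^ 2, 0; 0, (lam⁻¹) ^ 2]
            + lam • !![0, p x; q₁₀ x, 0]
            + g x • (1 : Matrix (Fin 2) (Fin 2) ℂ)
            + lam⁻¹ • !![0, q₁₀ x; p x, 0])).det
          = (f y • (!![lam ^ 2, 0; 0, (lam⁻¹) ^ 2]
            + lam • !![0, p y; q₁₀ y, 0]
            + g y • (1 : Matrix (Fin 2) (Fin 2) ℂ)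
            + lam⁻¹ • !![0, q₁₀ y; p y, 0])).det) := by
  have hΦ₁ : ∀ x, deriv (fun t => f t ^ 2 * (g t - p t * q₁₀ t)) x = 0 := by
    intro x
    have h := ((hf x).hasDerivAt.pow 2).mul
      ((hg x).hasDerivAt.sub ((hp x).hasDerivAt.mul (hq₁₀ x).hasDerivAt))
    refine h.deriv.trans ?_
    simp only [Pi.pow_apply, Pi.sub_apply, Pi.mul_apply, h1, h2, h3, h4]
    push_cast
    ring
  have hΦ₂ : ∀ x, deriv (fun t => f t ^ 2 * (g t ^ 2 + 1 - p t ^ 2 - q₁₀ t ^ 2)) x = 0 := by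
    intro x
    have h := ((hf x).hasDerivAt.pow 2).mul
      (((((hg x).hasDerivAt.pow 2).add_const 1).sub ((hp x).hasDerivAt.pow 2)).sub
        ((hq₁₀ x).hasDerivAt.pow 2))
    refine h.deriv.trans ?_
    simp only [Pi.pow_apply, Pi.sub_apply, h1, h2, h3, h4]
    push_cast
    ring
  refine ⟨hΦ₁, hΦ₂, fun lam hlam x => det_dihedral_darboux _ _ _ _ lam hlam,
    fun lam hlam x y => ?_⟩
  have e₁ := is_const_of_deriv_eq_zero (by fun_prop) hΦ₁ x y
  have e₂ := is_const_of_deriv_eq_zero (by fun_prop) hΦ₂ x y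
  rw [det_dihedral_darboux _ _ _ _ lam hlam, det_dihedral_darboux _ _ _ _ lam hlam, e₁, e₂]
end

section
/- Let p, p₁₀, q₁₀, q₁₁, f, g₁₀ be complex numbers with 1 + p·q₁₁ ≠ 0, and define p₀₁ = (q₁₀p² + (g₁₀ − f)p + p₁₀)/(1 + pq₁₁), q₀₁ = (p₁₀q₁₁² + (f − g₁₀)q₁₁ + q₁₀)/(1 + pq₁₁), f₀₁ = (q₁₁(p₁₀ + p·g₁₀) + f − p·q₁₀)/(1 + pq₁₁), and g = (q₁₁(p·f − p₁₀) + g₁₀ + p·q₁₀)/(1 + pq₁₁). Then the quantities F = f − p·q₁₀ and G = g − p·q₀₁ are first integrals of the lattice system: f₀₁ − p₀₁·q₁₁ = f − p·q₁₀ and g₁₀ − p₁₀·q₁₁ = g − p·q₀₁. -/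
/-- First integrals of the NLS lattice system: with `(p₀₁, q₀₁, f₀₁, g)` given by
the rational formulas solving the compatibility condition, the quantities
`F = f − p·q₁₀` and `G = g − p·q₀₁` satisfy `f₀₁ − p₀₁·q₁₁ = f − p·q₁₀` and
`g₁₀ − p₁₀·q₁₁ = g − p·q₀₁`. -/
theorem NLS_lattice_first_integrals
    (p p₁₀ q₁₀ q₁₁ f g₁₀ : ℂ) (h : 1 + p * q₁₁ ≠ 0) :
    ((q₁₁ * (p₁₀ + p * g₁₀) + f - p * q₁₀) / (1 + p * q₁₁))
        - ((q₁₀ * p ^ 2 + (g₁₀ - f) * p + p₁₀) / (1 + p * q₁₁)) * q₁₁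
      = f - p * q₁₀ ∧
    g₁₀ - p₁₀ * q₁₁
      = ((q₁₁ * (p * f - p₁₀) + g₁₀ + p * q₁₀) / (1 + p * q₁₁))
        - p * ((p₁₀ * q₁₁ ^ 2 + (f - g₁₀) * q₁₁ + q₁₀) / (1 + p * q₁₁)) := by
  constructor
  · rw [div_mul_eq_mul_div, ← sub_div, div_eq_iff h]
    ring
  · rw [mul_div_assoc', ← sub_div, eq_div_iff h]
    ring
end

section
/- Let a, b ∈ ℂ and let (x₁, x₂, X, y₁, y₂, Y) ∈ ℂ⁶ with 1 + x₁y₂ ≠ 0. Define u₁ = (y₁ + x₁²x₂ − x₁X + x₁Y)/(1 + x₁y₂), u₂ = y₂, v₁ = x₁, v₂ = (x₂ + y₁y₂² + y₂X − y₂Y)/(1 + x₁y₂), U = (y₁y₂ − x₁x₂ + X + x₁y₂Y)/(1 + x₁y₂), and V = (x₁x₂ − y₁y₂ + x₁y₂X + Y)/(1 + x₁y₂). Then: (1) Φ = X − x₁x₂ and Ψ = Y − y₁y₂ are invariants of this six-dimensional map, i.e. U − u₁u₂ = X − x₁x₂ and V − v₁v₂ = Y − y₁y₂; and (2) on the invariant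 leaves X = a + x₁x₂ and Y = b + y₁y₂ the map restricts to the Adler–Yamilov map: u₁ = y₁ − ((a−b)/(1 + x₁y₂))·x₁, u₂ = y₂, v₁ = x₁, v₂ = x₂ + ((a−b)/(1 + x₁y₂))·y₂, together with U = a + u₁u₂ and V = b + v₁v₂. -/
/-- The six-dimensional Yang–Baxter map associated with NLS: `Φ = X − x₁x₂` and
`Ψ = Y − y₁y₂` are invariants, and on the invariant leaves `X = a + x₁x₂`,
`Y = b + y₁y₂` the map restricts to the Adler–Yamilov map. -/
theorem NLS_sixDim_YB_invariants_restriction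
    (a b x₁ x₂ X y₁ y₂ Y : ℂ) (h : 1 + x₁ * y₂ ≠ 0) :
    let u₁ := (y₁ + x₁ ^ 2 * x₂ - x₁ * X + x₁ * Y) / (1 + x₁ * y₂)
    let u₂ := y₂
    let v₁ := x₁
    let v₂ := (x₂ + y₁ * y₂ ^ 2 + y₂ * X - y₂ * Y) / (1 + x₁ * y₂)
    let U := (y₁ * y₂ - x₁ * x₂ + X + x₁ * y₂ * Y) / (1 + x₁ * y₂)
    let V := (x₁ * x₂ - y₁ * y₂ + x₁ * y₂ * X + Y) / (1 + x₁ * y₂)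
    (U - u₁ * u₂ = X - x₁ * x₂ ∧ V - v₁ * v₂ = Y - y₁ * y₂) ∧
    (X = a + x₁ * x₂ → Y = b + y₁ * y₂ →
      u₁ = y₁ - ((a - b) / (1 + x₁ * y₂)) * x₁ ∧
      u₂ = y₂ ∧
      v₁ = x₁ ∧
      v₂ = x₂ + ((a - b) / (1 + x₁ * y₂)) * y₂ ∧
      U = a + u₁ * u₂ ∧ V = b + v₁ * v₂) := by
  intro u₁ u₂ v₁ v₂ U V
  have h' : 1 + y₂ * x₁ ≠ 0 := by rwa [mul_comm]
  have hU : U - u₁ * u₂ = X - x₁ * x₂ := by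
    simp only [U, u₁, u₂]
    field_simp
    ring
  have hV : V - v₁ * v₂ = Y - y₁ * y₂ := by
    simp only [V, v₁, v₂]
    field_simp
    ring
  refine ⟨⟨hU, hV⟩, fun hX hY => ⟨?_, rfl, rfl, ?_, ?_, ?_⟩⟩
  · simp only [u₁, hX, hY]
    field_simp
    ring
  · simp only [v₂, hX, hY]
    field_simp
    ring
  · linear_combination hU + hX
  · linear_combination hV + hY
end

section
/- Let a, b ∈ ℂ and let x₁, x₂, y₁, y₂ ∈ ℂ with 1 + x₁y₂ ≠ 0. Define the Adler–Yamilov image (u₁,u₂,v₁,v₂) by u₁ = y₁ − ((a−b)/(1 + x₁y₂))·x₁, u₂ = y₂, v₁ = x₁, v₂ = x₂ + ((a−b)/(1 + x₁y₂))·y₂, and for w₁, w₂ ∈ ℂ, c ∈ ℂ, λ ∈ ℂ define the 2×2 Lax matrix M(w₁,w₂;c,λ) = !![λ + c + w₁w₂, w₁; w₂, 1]. Then for every λ ∈ ℂ, M(u₁,u₂;a,λ) · M(v₁,v₂;b,λ) = M(y₁,y₂;b,λ) · M(x₁,x₂;a,λ); that is, the Adler–Yamilov map admits the Lax representation with Lax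 matrix M. -/
/-- The Lax matrix of the Adler–Yamilov map:
`M(w₁,w₂;c,λ) = !![λ + c + w₁w₂, w₁; w₂, 1]`. -/
noncomputable def MlaxAY (w₁ w₂ c lam : ℂ) : Matrix (Fin 2) (Fin 2) ℂ :=
  !![lam + c + w₁ * w₂, w₁; w₂, 1]

/-- The Adler–Yamilov map admits the Lax representation
`M(u;a,λ)·M(v;b,λ) = M(y;b,λ)·M(x;a,λ)` for all `λ`. -/
theorem AdlerYamilov_Lax_representation
    (a b x₁ x₂ y₁ y₂ : ℂ) (h : 1 + x₁ * y₂ ≠ 0) :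
    let u₁ := y₁ - ((a - b) / (1 + x₁ * y₂)) * x₁
    let u₂ := y₂
    let v₁ := x₁
    let v₂ := x₂ + ((a - b) / (1 + x₁ * y₂)) * y₂
    ∀ lam : ℂ,
      MlaxAY u₁ u₂ a lam * MlaxAY v₁ v₂ b lam
        = MlaxAY y₁ y₂ b lam * MlaxAY x₁ x₂ a lam := by
  intro u₁ u₂ v₁ v₂ lam
  simp only [u₁, u₂, v₁, v₂]
  generalize hk : (a - b) / (1 + x₁ * y₂) = k
  rw [div_eq_iff h] at hk
  obtain rfl : a = b + k * (1 + x₁ * y₂) := by linear_combination hk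
  ext i j
  fin_cases i <;> fin_cases j <;>
    simp [MlaxAY, Matrix.mul_apply, Fin.sum_univ_two] <;> ring
end

section
/- Let a, b ∈ ℂ and let x₁, x₂, y₁, y₂ ∈ ℂ with 1 + x₁y₂ ≠ 0, and define the Adler–Yamilov image u₁ = y₁ − ((a−b)/(1 + x₁y₂))·x₁, u₂ = y₂, v₁ = x₁, v₂ = x₂ + ((a−b)/(1 + x₁y₂))·y₂. Define I₁(x₁,x₂,y₁,y₂) = x₁x₂ + y₁y₂ and I₂(x₁,x₂,y₁,y₂) = (a + x₁x₂)(b + y₁y₂) + x₁y₂ + x₂y₁. Then: (1) both quantities are invariants of the Adler–Yamilov map, i.e. u₁u₂ + v₁v₂ = x₁x₂ + y₁y₂ and (a + u₁u₂)(b + v₁v₂) + u₁v₂ + u₂v₁ = (a + x₁x₂)(b + y₁y₂) + x₁y₂ + x₂y₁; and (2) I₁ and I₂ are in involution with respect to the canonical Poisson bracket {x₁,x₂} = {y₁,y₂} = 1 (all other brackets of coordinates zero), i.e. (∂I₁/∂x₁)(∂I₂/∂x₂) − (∂I₁/∂x₂)(∂I₂/∂x₁) + (∂I₁/∂y₁)(∂I₂/∂y₂)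 − (∂I₁/∂y₂)(∂I₂/∂y₁) = 0 identically on ℂ⁴. -/
/-- The derivative of a function that agrees everywhere with `s ↦ p * s + q` is `p`. -/
theorem deriv_of_forall_eq_affine {f : ℂ → ℂ} (p q x : ℂ) (hf : ∀ s, f s = p * s + q) :
    deriv f x = p := by
  rw [funext hf]
  simp


/-- Complete integrability data for the Adler–Yamilov map: the functions
`I₁ = x₁x₂ + y₁y₂` and `I₂ = (a + x₁x₂)(b + y₁y₂) + x₁y₂ + x₂y₁` are invariants of
the map, and they are in involution with respect to the canonical Poisson bracket
`{x₁,x₂} = {y₁,y₂} = 1` (all other brackets of coordinates zero). -/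
theorem AdlerYamilov_integrability
    (a b : ℂ) :
    (∀ x₁ x₂ y₁ y₂ : ℂ, 1 + x₁ * y₂ ≠ 0 →
      let u₁ := y₁ - ((a - b) / (1 + x₁ * y₂)) * x₁
      let u₂ := y₂
      let v₁ := x₁
      let v₂ := x₂ + ((a - b) / (1 + x₁ * y₂)) * y₂
      u₁ * u₂ + v₁ * v₂ = x₁ * x₂ + y₁ * y₂ ∧
      (a + u₁ * u₂) * (b + v₁ * v₂) + u₁ * v₂ + u₂ * v₁
        = (a + x₁ * x₂) * (b + y₁ * y₂) + x₁ * y₂ + x₂ * y₁) ∧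
    (∀ x₁ x₂ y₁ y₂ : ℂ,
      let I₁ : ℂ → ℂ → ℂ → ℂ → ℂ := fun s₁ s₂ t₁ t₂ => s₁ * s₂ + t₁ * t₂
      let I₂ : ℂ → ℂ → ℂ → ℂ → ℂ := fun s₁ s₂ t₁ t₂ =>
        (a + s₁ * s₂) * (b + t₁ * t₂) + s₁ * t₂ + s₂ * t₁
      deriv (fun s => I₁ s x₂ y₁ y₂) x₁ * deriv (fun s => I₂ x₁ s y₁ y₂) x₂
        - deriv (fun s => I₁ x₁ s y₁ y₂) x₂ * deriv (fun s => I₂ s x₂ y₁ y₂) x₁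
        + deriv (fun s => I₁ x₁ x₂ s y₂) y₁ * deriv (fun s => I₂ x₁ x₂ y₁ s) y₂
        - deriv (fun s => I₁ x₁ x₂ y₁ s) y₂ * deriv (fun s => I₂ x₁ x₂ s y₂) y₁
        = 0) := by
  refine ⟨fun x₁ x₂ y₁ y₂ h => ?_, fun x₁ x₂ y₁ y₂ => ?_⟩
  · have hc : (a - b) / (1 + x₁ * y₂) * (1 + x₁ * y₂) = a - b := div_mul_cancel₀ _ h
    generalize (a - b) / (1 + x₁ * y₂) = c at hc
    refine ⟨by ring, ?_⟩
    linear_combination (y₁ * y₂ - x₁ * x₂ - c * (x₁ * y₂)) * hc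
  · intro I₁ I₂
    rw [deriv_of_forall_eq_affine x₂ (y₁ * y₂) x₁ fun s => by ring,
      deriv_of_forall_eq_affine (x₁ * (b + y₁ * y₂) + y₁) (a * (b + y₁ * y₂) + x₁ * y₂) x₂
        fun s => by ring,
      deriv_of_forall_eq_affine x₁ (y₁ * y₂) x₂ fun s => by ring,
      deriv_of_forall_eq_affine (x₂ * (b + y₁ * y₂) + y₂) (a * (b + y₁ * y₂) + x₂ * y₁) x₁
        fun s => by ring,
      deriv_of_forall_eq_affine y₂ (x₁ * x₂) y₁ fun s => by ring,
      deriv_of_forall_eq_affine (y₁ * (a + x₁ * x₂) + x₁) (b * (a + x₁ * x₂) + x₂ * y₁) y₂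
        fun s => by ring,
      deriv_of_forall_eq_affine y₁ (x₁ * x₂) y₂ fun s => by ring,
      deriv_of_forall_eq_affine (y₂ * (a + x₁ * x₂) + x₂) (b * (a + x₁ * x₂) + x₁ * y₂) y₁
        fun s => by ring]
    ring
end
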